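/- arXiv:1608.06372 — 3 statements merged into one kernel-verified Lean document; each statement's English description precedes it below -/
import Mathlib

section
/- Assume r ≥ 2. For every n ≥ 1, one has I_n = ⟨I_{n−1}⟩_{K[X_n]} + x_n^{a_r} · ⟨J_{n−δ_r}⟩_{K[X_n]}, where ⟨·⟩_{K[X_n]} denotes the ideal of K[X_n] generated by the indicated set, δ_r = μ_r − μ_{r−1} ≥ 1, and J_m is defined to be the zero ideal for m < 0. -/
open MvPolynomial

noncomputable section

/-- The monomial `x_{μ 0}^{a 0} ⋯ x_{μ (r-1)}^{a (r-1)}` in `K[X] = K[x_j : j ≥ 1]`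
(variables indexed by `ℕ`; only indices `≥ 1` occur). -/
def orbMon (K : Type*) [Field K] (r : ℕ) (μ a : ℕ → ℕ) : MvPolynomial ℕ K :=
  ∏ j ∈ Finset.range r, (X (μ j) : MvPolynomial ℕ K) ^ a j

/-- The ideal generated by the `Inc`-orbit of a polynomial, where the monoid `Inc` of
strictly increasing maps acts by renaming the indices of the variables. -/
def orbitIdeal (K : Type*) [Field K] (m : MvPolynomial ℕ K) : Ideal (MvPolynomial ℕ K) :=
  Ideal.span {q | ∃ π : ℕ → ℕ, StrictMono π ∧ q = rename π m}

/-- Index type for the variables `x_1, …, x_n` of `K[X_n]`. -/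
abbrev VarIdx (n : ℕ) := {j : ℕ // j ∈ Finset.Icc 1 n}

/-- The inclusion `K[X_n] → K[X]`. -/
def toBig (K : Type*) [Field K] (n : ℕ) : MvPolynomial (VarIdx n) K →ₐ[K] MvPolynomial ℕ K :=
  rename Subtype.val

/-- `I_n = I ∩ K[X_n]`, realized as an ideal of `K[X_n]` (this is legitimate because
`toBig` is injective). -/
def restr (K : Type*) [Field K] (I : Ideal (MvPolynomial ℕ K)) (n : ℕ) :
    Ideal (MvPolynomial (VarIdx n) K) :=
  Ideal.comap (toBig K n) I

/-- The inclusion `K[X_m] → K[X_n]` for `m ≤ n`. -/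
def incl (K : Type*) [Field K] {m n : ℕ} (h : m ≤ n) :
    MvPolynomial (VarIdx m) K →ₐ[K] MvPolynomial (VarIdx n) K :=
  rename fun j => ⟨j.1, Finset.Icc_subset_Icc le_rfl h j.2⟩

/-- The dimension of the degree `j` component of `K[X_n]/I`, for a homogeneous ideal `I`:
the `K`-dimension of (homogeneous polynomials of degree `j`) modulo (those lying in `I`). -/
def hilbF (K : Type*) [Field K] {σ : Type*} (I : Ideal (MvPolynomial σ K)) (j : ℕ) : ℕ :=
  Module.finrank K
    (↥(homogeneousSubmodule σ K j) ⧸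
      (Submodule.comap (homogeneousSubmodule σ K j).subtype (Submodule.restrictScalars K I)))

/-- The Hilbert series of `K[X_n]/I` as a power series in `ℤ[[t]]`. -/
def hseries (K : Type*) [Field K] {σ : Type*} (I : Ideal (MvPolynomial σ K)) :
    PowerSeries ℤ :=
  PowerSeries.mk fun j => (hilbF K I j : ℤ)

end

theorem index_le_of_lt_succ {r : ℕ} {μ : ℕ → ℕ} (hμ : ∀ i < r, μ i < μ (i + 1)) {j : ℕ}
    (hj : j ≤ r) : μ j ≤ μ r := by
  induction r, hj using Nat.le_induction with
  | base => exact le_rfl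
  | succ k _ ih =>
    exact (ih fun i hi => hμ i (by omega)).trans (hμ k (Nat.lt_succ_self k)).le

/-- The exponent vector of the monomial `x_{ν 0}^{a 0} ⋯ x_{ν (r-1)}^{a (r-1)}`. -/
noncomputable def orbExp (r : ℕ) (ν a : ℕ → ℕ) : ℕ →₀ ℕ :=
  ∑ j ∈ Finset.range r, Finsupp.single (ν j) (a j)

theorem orbExp_congr {r : ℕ} {ν ν' a : ℕ → ℕ} (h : ∀ j < r, ν j = ν' j) :
    orbExp r ν a = orbExp r ν' a :=
  Finset.sum_congr rfl fun j hj => by rw [h j (Finset.mem_range.mp hj)]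

theorem le_orbExp_apply {r : ℕ} (ν a : ℕ → ℕ) {j : ℕ} (hj : j < r) :
    a j ≤ orbExp r ν a (ν j) := by
  have h : Finsupp.single (ν j) (a j) ≤ orbExp r ν a :=
    Finset.single_le_sum (f := fun j => Finsupp.single (ν j) (a j))
      (fun _ _ => zero_le) (Finset.mem_range.mpr hj)
  simpa using h (ν j)

theorem orbExp_apply_eq_zero {r : ℕ} {ν a : ℕ → ℕ} {i : ℕ} (h : ∀ j < r, ν j ≠ i) :
    orbExp r ν a i = 0 := by
  rw [orbExp, Finsupp.finsetSum_apply]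
  exact Finset.sum_eq_zero fun j hj => by simp [h j (Finset.mem_range.mp hj)]

theorem rename_orbMon (K : Type*) [Field K] (r : ℕ) (μ a π : ℕ → ℕ) :
    rename π (orbMon K r μ a) = monomial (orbExp r (π ∘ μ) a) 1 := by
  simp [orbMon, orbExp, monomial_sum_one, X_pow_eq_monomial, rename_monomial]

theorem mem_orbitIdeal_orbMon {K : Type*} [Field K] {r : ℕ} {μ a : ℕ → ℕ}
    {f : MvPolynomial ℕ K} :
    f ∈ orbitIdeal K (orbMon K r μ a) ↔
      ∀ s ∈ f.support, ∃ π : ℕ → ℕ, StrictMono π ∧ orbExp r (π ∘ μ) a ≤ s := by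
  have h : {q | ∃ π : ℕ → ℕ, StrictMono π ∧ q = rename π (orbMon K r μ a)} =
      (fun s => monomial s (1 : K)) '' {e | ∃ π : ℕ → ℕ, StrictMono π ∧
        e = orbExp r (π ∘ μ) a} := by
    ext q
    constructor
    · rintro ⟨π, hπ, rfl⟩
      exact ⟨_, ⟨π, hπ, rfl⟩, (rename_orbMon K r μ a π).symm⟩
    · rintro ⟨_, ⟨π, hπ, rfl⟩, rfl⟩
      exact ⟨π, hπ, (rename_orbMon K r μ a π).symm⟩
  rw [orbitIdeal, h, mem_ideal_span_monomial_image]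
  refine forall₂_congr fun s _ => ?_
  constructor
  · rintro ⟨_, ⟨π, hπ, rfl⟩, hs⟩
    exact ⟨π, hπ, hs⟩
  · rintro ⟨π, hπ, hs⟩
    exact ⟨_, ⟨π, hπ, rfl⟩, hs⟩

theorem mem_restr_orbitIdeal_orbMon {K : Type*} [Field K] {r n : ℕ} {μ a : ℕ → ℕ}
    {f : MvPolynomial (VarIdx n) K} :
    f ∈ restr K (orbitIdeal K (orbMon K r μ a)) n ↔
      ∀ s ∈ f.support, ∃ π : ℕ → ℕ, StrictMono π ∧
        orbExp r (π ∘ μ) a ≤ s.mapDomain Subtype.val := by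
  classical
  rw [restr, Ideal.mem_comap, mem_orbitIdeal_orbMon, toBig,
    support_rename_of_injective Subtype.val_injective]
  simp only [Finset.forall_mem_image]

theorem toBig_incl (K : Type*) [Field K] {m n : ℕ} (h : m ≤ n)
    (f : MvPolynomial (VarIdx m) K) : toBig K n (incl K h f) = toBig K m f := by
  rw [toBig, incl, toBig, rename_rename]
  rfl

theorem map_incl_restr_le (K : Type*) [Field K] {m n : ℕ} (h : m ≤ n)
    (I : Ideal (MvPolynomial ℕ K)) : Ideal.map (incl K h) (restr K I m) ≤ restr K I n := by
  rw [Ideal.map_le_iff_le_comap]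
  intro f hf
  rw [Ideal.mem_comap, restr, Ideal.mem_comap, toBig_incl]
  exact hf

theorem mapDomain_val_apply_eq_zero {n : ℕ} (s : VarIdx n →₀ ℕ) {i : ℕ}
    (hi : i ∉ Finset.Icc 1 n) : s.mapDomain Subtype.val i = 0 :=
  Finsupp.mapDomain_of_notMem_range _ _ fun ⟨j, hj⟩ => hi (hj ▸ j.2)

/-- The indices of the variables of a monomial dividing a monomial of `K[X_n]` lie in `[1, n]`. -/
theorem mem_Icc_of_orbExp_le {r n : ℕ} {ν a : ℕ → ℕ} (ha : ∀ j < r, 0 < a j)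
    {s : VarIdx n →₀ ℕ} (h : orbExp r ν a ≤ s.mapDomain Subtype.val) {j : ℕ} (hj : j < r) :
    ν j ∈ Finset.Icc 1 n := by
  by_contra hi
  have h₁ := le_orbExp_apply ν a hj
  have h₂ := h (ν j)
  rw [mapDomain_val_apply_eq_zero s hi] at h₂
  have := ha j hj
  omega

/-- An orbit monomial in the variables `x_1, …, x_m` lies in `K[X_m]`. -/
theorem exists_mapDomain_eq_orbExp {r m : ℕ} {ν a : ℕ → ℕ}
    (h : ∀ j < r, ν j ∈ Finset.Icc 1 m) :
    ∃ u : VarIdx m →₀ ℕ, u.mapDomain Subtype.val = orbExp r ν a := by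
  refine ⟨(orbExp r ν a).subtypeDomain (· ∈ Finset.Icc 1 m), ?_⟩
  ext i
  by_cases hi : i ∈ Finset.Icc 1 m
  · exact Finsupp.mapDomain_apply Subtype.val_injective _ (⟨i, hi⟩ : VarIdx m)
  · rw [mapDomain_val_apply_eq_zero _ hi, orbExp_apply_eq_zero]
    rintro j hj rfl
    exact hi (h j hj)

theorem le_of_mapDomain_val_le {n : ℕ} {u s : VarIdx n →₀ ℕ}
    (h : u.mapDomain Subtype.val ≤ s.mapDomain Subtype.val) : u ≤ s := by
  intro i
  have := h i.1
  rwa [Finsupp.mapDomain_apply Subtype.val_injective,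
    Finsupp.mapDomain_apply Subtype.val_injective] at this

theorem monomial_mem_of_le {σ K : Type*} [Field K] {I : Ideal (MvPolynomial σ K)}
    {u s : σ →₀ ℕ} (h : u ≤ s) (hu : monomial u (1 : K) ∈ I) (c : K) : monomial s c ∈ I := by
  refine I.mem_of_dvd ?_ hu
  rw [monomial_dvd_monomial]
  exact ⟨Or.inr h, one_dvd c⟩

/-- Orbit monomials in the variables `x_1, …, x_m` generate the extension of `I_m` to `K[X_n]`. -/
theorem exists_monomial_mem_map_incl_restr (K : Type*) [Field K] {r m n : ℕ} (hmn : m ≤ n)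
    {μ a π : ℕ → ℕ} (hπ : StrictMono π) (h : ∀ j < r, π (μ j) ∈ Finset.Icc 1 m) :
    ∃ u : VarIdx n →₀ ℕ, u.mapDomain Subtype.val = orbExp r (π ∘ μ) a ∧
      monomial u (1 : K) ∈
        Ideal.map (incl K hmn) (restr K (orbitIdeal K (orbMon K r μ a)) m) := by
  obtain ⟨u, hu⟩ := exists_mapDomain_eq_orbExp (ν := π ∘ μ) (a := a) h
  refine ⟨u.mapDomain fun j => ⟨j.1, Finset.Icc_subset_Icc le_rfl hmn j.2⟩, ?_, ?_⟩
  · rw [← Finsupp.mapDomain_comp, ← hu]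
    rfl
  · rw [← rename_monomial]
    refine Ideal.mem_map_of_mem (incl K hmn) (mem_restr_orbitIdeal_orbMon.mpr fun s hs => ?_)
    obtain rfl := Finset.mem_singleton.mp (support_monomial_subset hs)
    exact ⟨π, hπ, hu.ge⟩

/-- A strictly increasing map can be modified beyond `p` so as to send `q` to `n`, as long as
this leaves enough room between the images of `p` and `q`. -/
theorem StrictMono.exists_extend {π : ℕ → ℕ} (hπ : StrictMono π) {p q n : ℕ} (hpq : p < q)
    (h : π p + (q - p) ≤ n) :
    ∃ π' : ℕ → ℕ, StrictMono π' ∧ (∀ i ≤ p, π' i = π i) ∧ π' q = n := by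
  refine ⟨fun i => if i ≤ p then π i else n + i - q, ?_, fun i hi => if_pos hi, ?_⟩
  · refine strictMono_nat_of_lt_succ fun i => ?_
    have h₁ := hπ (Nat.lt_succ_self i)
    rcases lt_trichotomy i p with hi | rfl | hi
    · simpa [hi.le, Nat.succ_le_of_lt hi] using h₁
    · simp
      omega
    · have h₂ : ¬ i ≤ p := by omega
      have h₃ : ¬ i + 1 ≤ p := by omega
      simp only [h₂, h₃, if_false]
      omega
  · simp [hpq.not_ge]

theorem X_pow_mul_incl_mem_restr (K : Type*) [Field K] {r : ℕ} {μ a : ℕ → ℕ}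
    (hμ : ∀ j, j + 1 < r + 2 → μ j < μ (j + 1)) (ha : ∀ j, j < r + 2 → 0 < a j) {n : ℕ}
    (hn : n ∈ Finset.Icc 1 n) (hδ : μ (r + 1) - μ r ≤ n)
    {f : MvPolynomial (VarIdx (n - (μ (r + 1) - μ r))) K}
    (hf : f ∈ restr K (orbitIdeal K (orbMon K (r + 1) μ a)) (n - (μ (r + 1) - μ r))) :
    (X (⟨n, hn⟩ : VarIdx n) : MvPolynomial (VarIdx n) K) ^ a (r + 1) *
        incl K (Nat.sub_le n (μ (r + 1) - μ r)) f ∈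
      restr K (orbitIdeal K (orbMon K (r + 2) μ a)) n := by
  have hmono : ∀ j ≤ r, μ j ≤ μ r := fun j hj =>
    index_le_of_lt_succ (fun i hi => hμ i (by omega)) hj
  rw [mem_restr_orbitIdeal_orbMon] at hf
  have hX : toBig K n (X ⟨n, hn⟩) = X n := rename_X _ _
  rw [restr, Ideal.mem_comap, map_mul, toBig_incl, map_pow, hX, f.as_sum, map_sum,
    Finset.mul_sum]
  refine Ideal.sum_mem _ fun s hs => ?_
  obtain ⟨π, hπ, hle⟩ := hf s hs
  have hr := mem_Icc_of_orbExp_le (fun j hj => ha j (by omega)) hle (Nat.lt_succ_self r)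
  obtain ⟨π', hπ', heq, hlast⟩ := hπ.exists_extend (n := n) (hμ r (by omega)) (by
    have := (Finset.mem_Icc.mp hr).2
    simp only [Function.comp_apply] at this
    omega)
  rw [toBig, rename_monomial, X_pow_eq_monomial, monomial_mul, one_mul]
  refine mem_orbitIdeal_orbMon.mpr fun t ht => ?_
  obtain rfl := Finset.mem_singleton.mp (support_monomial_subset ht)
  refine ⟨π', hπ', ?_⟩
  rw [orbExp, Finset.sum_range_succ, add_comm]
  refine add_le_add (by simp [hlast]) (le_of_eq_of_le ?_ hle)
  exact orbExp_congr fun j hj => heq _ (hmono j (by omega))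

/-- For `n ≥ 1`, `I_n = ⟨I_{n-1}⟩_{K[X_n]} + x_n^{a_r}·⟨J_{n-δ_r}⟩_{K[X_n]}`,
with `δ_r = μ_r - μ_{r-1}` and `J_m := 0` for `m < 0`. -/
theorem statement1 (K : Type*) [Field K] (r : ℕ) (hr : 2 ≤ r) (μ a : ℕ → ℕ)
    (hμ1 : 1 ≤ μ 0) (hμ : ∀ j, j + 1 < r → μ j < μ (j + 1))
    (ha : ∀ j, j < r → 0 < a j) (n : ℕ) (hn : 1 ≤ n) :
    restr K (orbitIdeal K (orbMon K r μ a)) n =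
      Ideal.map (incl K (Nat.sub_le n 1)) (restr K (orbitIdeal K (orbMon K r μ a)) (n - 1)) +
      (if n < μ (r - 1) - μ (r - 2) then (⊥ : Ideal (MvPolynomial (VarIdx n) K))
       else
        Ideal.span {(X (⟨n, Finset.mem_Icc.mpr ⟨hn, le_rfl⟩⟩ : VarIdx n) :
            MvPolynomial (VarIdx n) K) ^ a (r - 1)} *
          Ideal.map (incl K (Nat.sub_le n (μ (r - 1) - μ (r - 2))))
            (restr K (orbitIdeal K (orbMon K (r - 1) μ a)) (n - (μ (r - 1) - μ (r - 2))))) := by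
  obtain ⟨r, rfl⟩ := Nat.exists_eq_add_of_le' hr
  simp only [Nat.add_sub_cancel, show r + 2 - 1 = r + 1 from rfl]
  have hlt : μ r < μ (r + 1) := hμ r (by omega)
  apply le_antisymm
  · intro f hf
    rw [mem_restr_orbitIdeal_orbMon] at hf
    rw [f.as_sum]
    refine Ideal.sum_mem _ fun s hs => ?_
    obtain ⟨π, hπ, hle⟩ := hf s hs
    have hmem : ∀ j < r + 2, π (μ j) ∈ Finset.Icc 1 n := fun j hj =>
      mem_Icc_of_orbExp_le ha hle hj
    have hmono : ∀ j ≤ r + 1, π (μ j) ≤ π (μ (r + 1)) := fun j hj =>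
      hπ.monotone (index_le_of_lt_succ (fun i hi => hμ i (by omega)) hj)
    have hgap : π (μ r) + (μ (r + 1) - μ r) ≤ π (μ (r + 1)) := by
      have := hπ.add_le_nat (μ (r + 1) - μ r) (μ r)
      rw [Nat.sub_add_cancel hlt.le] at this
      omega
    have hlast := Finset.mem_Icc.mp (hmem (r + 1) (by omega))
    by_cases hn' : π (μ (r + 1)) = n
    · rw [if_neg (by omega)]
      obtain ⟨u, hu, hmemu⟩ := exists_monomial_mem_map_incl_restr K (r := r + 1) (a := a)
        (Nat.sub_le n (μ (r + 1) - μ r)) hπ fun j hj => by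
          have h₁ := hπ.monotone
            (index_le_of_lt_succ (r := r) (fun i hi => hμ i (by omega)) (Nat.le_of_lt_succ hj))
          have h₂ := Finset.mem_Icc.mp (hmem j (by omega))
          exact Finset.mem_Icc.mpr ⟨h₂.1, by omega⟩
      refine Ideal.mem_sup_right (monomial_mem_of_le ?_
        (by
          have := Ideal.mul_mem_mul (Ideal.mem_span_singleton_self
            ((X (⟨n, Finset.mem_Icc.mpr ⟨hn, le_rfl⟩⟩ : VarIdx n) :
              MvPolynomial (VarIdx n) K) ^ a (r + 1))) hmemu
          rwa [X_pow_eq_monomial, monomial_mul, one_mul, ← X_pow_eq_monomial] at this) _)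
      apply le_of_mapDomain_val_le
      rw [Finsupp.mapDomain_add, Finsupp.mapDomain_single, hu, add_comm]
      rw [orbExp, Finset.sum_range_succ, Function.comp_apply, hn'] at hle
      exact hle
    · obtain ⟨u, hu, hmemu⟩ := exists_monomial_mem_map_incl_restr K (r := r + 2) (a := a)
        (Nat.sub_le n 1) hπ fun j hj => by
          have h₁ := hmono j (by omega)
          have h₂ := Finset.mem_Icc.mp (hmem j hj)
          exact Finset.mem_Icc.mpr ⟨h₂.1, by omega⟩
      exact Ideal.mem_sup_left (monomial_mem_of_le
        (le_of_mapDomain_val_le (hu.trans_le hle)) hmemu _)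
  · refine sup_le (map_incl_restr_le K _ _) ?_
    split_ifs with h
    · exact bot_le
    · rw [Ideal.map, Ideal.span_mul_span', Ideal.span_le]
      rintro _ ⟨_, rfl, _, ⟨f, hf, rfl⟩, rfl⟩
      exact X_pow_mul_incl_mem_restr K hμ ha _ (by omega) hf
end

section
/- For every n ≥ μ_r − 1, the power series f_n(t) := (1−t)^{μ_r−1} · H_{A_n}(t) is a polynomial in ℤ[t], and its value at t = 1 equals the coefficient of t^{n−μ_r+1} in the power series ∏_{i=1}^{r} 1/(1 − a_i t); that is, f_n(1) = Σ a_1^{k_1} a_2^{k_2} ⋯ a_r^{k_r}, where the sum runs over all tuples (k_1, …, k_r) of non-negative integers with k_1 + ⋯ + k_r = n − μ_r + 1. -/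
open MvPolynomial

theorem strictMonoOn_Iio_of_lt_succ {r : ℕ} {μ : ℕ → ℕ}
    (hμ : ∀ j, j + 1 < r → μ j < μ (j + 1)) : StrictMonoOn μ (Set.Iio r) := by
  intro i _ j hj hij
  induction j with
  | zero => omega
  | succ j ih =>
    have h1 := hμ j hj
    rcases Nat.lt_succ_iff_lt_or_eq.1 hij with h | rfl
    · exact (ih (Set.mem_Iio.2 (by grind)) h).trans h1
    · exact h1

/-- The sequence `v` contains a leftmost-to-rightmost pattern `L`: each entry `(g, b)` asks for
skipping at least `g` positions and then reading a value that is at least `b`. -/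
def HasPattern : List (ℕ × ℕ) → (ℕ → ℕ) → Prop
  | [], _ => True
  | x :: L, v => ∃ k, x.1 ≤ k ∧ x.2 ≤ v k ∧ HasPattern L fun i => v (k + 1 + i)

theorem HasPattern.of_drop {L : List (ℕ × ℕ)} {v : ℕ → ℕ} (m : ℕ)
    (h : HasPattern L fun i => v (m + i)) : HasPattern L v := by
  cases L with
  | nil => trivial
  | cons x L =>
    obtain ⟨k, h1, h2, h3⟩ := h
    refine ⟨m + k, by omega, h2, ?_⟩
    convert h3 using 3
    omega

theorem hasPattern_succ_cons (g b : ℕ) (L : List (ℕ × ℕ)) (v : ℕ → ℕ) :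
    HasPattern ((g + 1, b) :: L) v ↔ HasPattern ((g, b) :: L) fun i => v (i + 1) := by
  constructor
  · rintro ⟨k, h1, h2, h3⟩
    obtain ⟨k, rfl⟩ : ∃ k', k = k' + 1 := ⟨k - 1, by grind⟩
    refine ⟨k, by grind, h2, ?_⟩
    convert h3 using 3
    omega
  · rintro ⟨k, h1, h2, h3⟩
    refine ⟨k + 1, by grind, h2, ?_⟩
    convert h3 using 3
    omega

theorem hasPattern_zero_cons_of_le {b : ℕ} {L : List (ℕ × ℕ)} {v : ℕ → ℕ} (h : b ≤ v 0) :
    HasPattern ((0, b) :: L) v ↔ HasPattern L fun i => v (i + 1) := by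
  constructor
  · rintro ⟨k, -, -, h3⟩
    refine HasPattern.of_drop k ?_
    convert h3 using 3
    omega
  · intro h3
    refine ⟨0, le_rfl, h, ?_⟩
    convert h3 using 3
    omega

theorem hasPattern_zero_cons_of_lt {b : ℕ} {L : List (ℕ × ℕ)} {v : ℕ → ℕ} (h : v 0 < b) :
    HasPattern ((0, b) :: L) v ↔ HasPattern ((0, b) :: L) fun i => v (i + 1) := by
  rw [← hasPattern_succ_cons]
  constructor
  · rintro ⟨k, -, h2, h3⟩
    refine ⟨k, ?_, h2, h3⟩
    rcases k with _ | k
    · grind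
    · simp
  · rintro ⟨k, -, h2, h3⟩
    exact ⟨k, Nat.zero_le k, h2, h3⟩

/-- The pattern whose occurrences in `v` are the translates by increasing maps of the
requirements `a j ≤ v (μ j)`, `j < r`. -/
def gapList : ℕ → (ℕ → ℕ) → (ℕ → ℕ) → List (ℕ × ℕ)
  | 0, _, _ => []
  | r + 1, μ, a => (μ 0, a 0) :: gapList r (fun i => μ (i + 1) - μ 0 - 1) fun i => a (i + 1)

theorem hasPattern_gapList (r : ℕ) (μ a v : ℕ → ℕ) (hμ : ∀ j, j + 1 < r → μ j < μ (j + 1)) :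
    HasPattern (gapList r μ a) v ↔
      ∃ π : ℕ → ℕ, StrictMono π ∧ ∀ j < r, a j ≤ v (π (μ j)) := by
  induction r generalizing μ a v with
  | zero => simpa [gapList, HasPattern] using ⟨id, strictMono_id⟩
  | succ r ih =>
    have h0 : ∀ j, j < r → μ 0 < μ (j + 1) := fun j hj =>
      strictMonoOn_Iio_of_lt_succ hμ (Set.mem_Iio.2 (by omega)) (Set.mem_Iio.2 (by omega)) (by omega)
    have hμ' : ∀ j, j + 1 < r → μ (j + 1) - μ 0 - 1 < μ (j + 1 + 1) - μ 0 - 1 := by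
      intro j hj
      have := hμ (j + 1) (by omega)
      have := h0 j (by omega)
      omega
    simp only [gapList, HasPattern]
    constructor
    · rintro ⟨k, h1, h2, h3⟩
      obtain ⟨π, hπ, h⟩ := (ih _ _ _ hμ').1 h3
      refine ⟨fun x => if x < μ 0 then x else if x = μ 0 then k else k + 1 + π (x - μ 0 - 1),
        ?_, ?_⟩
      · intro x y hxy
        have : μ 0 < x → π (x - μ 0 - 1) < π (y - μ 0 - 1) := fun hx => hπ (by omega)
        grind
      · intro j hj
        rcases j with _ | j
        · simpa using h2
        · have := h0 j (by omega)
          simpa [this.not_gt, this.ne'] using h j (by omega)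
    · rintro ⟨π, hπ, h⟩
      refine ⟨π (μ 0), hπ.id_le _, h 0 (by omega), (ih _ _ _ hμ').2
        ⟨fun x => π (x + μ 0 + 1) - π (μ 0) - 1, ?_, ?_⟩⟩
      · intro x y hxy
        have h1 : π (μ 0) < π (x + μ 0 + 1) := hπ (by omega)
        have h2 : π (x + μ 0 + 1) < π (y + μ 0 + 1) := hπ (by omega)
        grind
      · intro j hj
        have h1 := h0 j hj
        have h2 := hπ h1
        convert h (j + 1) (by omega) using 2
        dsimp only
        rw [show μ (j + 1) - μ 0 - 1 + μ 0 + 1 = μ (j + 1) by omega]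
        omega

/-- Extension of a finite word by zero. -/
def extendZero {n : ℕ} (u : Fin n → ℕ) (i : ℕ) : ℕ :=
  if h : i < n then u ⟨i, h⟩ else 0

theorem extendZero_cons_zero {n : ℕ} (x : ℕ) (u : Fin n → ℕ) :
    extendZero (Fin.cons x u : Fin (n + 1) → ℕ) 0 = x := by
  simp [extendZero]

theorem extendZero_cons_succ {n : ℕ} (x : ℕ) (u : Fin n → ℕ) :
    (fun i => extendZero (Fin.cons x u : Fin (n + 1) → ℕ) (i + 1)) = extendZero u := by
  funext i
  by_cases h : i < n
  · simpa [extendZero, h] using Fin.cons_succ (α := fun _ => ℕ) x u ⟨i, h⟩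
  · simp [extendZero, h]

theorem sum_antidiagonalTuple_succ {M : Type*} [AddCommMonoid M] (n d : ℕ)
    (f : (Fin (n + 1) → ℕ) → M) :
    ∑ u ∈ Finset.Nat.antidiagonalTuple (n + 1) d, f u =
      ∑ p ∈ Finset.HasAntidiagonal.antidiagonal d, ∑ u ∈ Finset.Nat.antidiagonalTuple n p.2,
        f (Fin.cons p.1 u) := by
  rw [Finset.sum_sigma']
  refine Finset.sum_bij' (fun u _ => ⟨(u 0, ∑ i : Fin n, u i.succ), Fin.tail u⟩)
    (fun q _ => Fin.cons q.1.1 q.2) ?_ ?_ ?_ ?_ ?_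
  · intro u hu
    rw [Finset.Nat.mem_antidiagonalTuple, Fin.sum_univ_succ] at hu
    simpa [Finset.Nat.mem_antidiagonalTuple, Fin.tail] using hu
  · rintro ⟨⟨i, j⟩, u⟩ h
    simp only [Finset.mem_sigma, Finset.HasAntidiagonal.mem_antidiagonal,
      Finset.Nat.mem_antidiagonalTuple] at h
    simp [Finset.Nat.mem_antidiagonalTuple, Fin.sum_univ_succ, h]
  · intro u _
    simp
  · rintro ⟨⟨i, j⟩, u⟩ h
    have : ∑ k, u k = j := by grind [Finset.Nat.mem_antidiagonalTuple]
    subst this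
    simp
  · intro u _
    simp

/-- The generating series, by sum of entries, of the words of length `n` avoiding `L`. -/
noncomputable def avoidSeries (L : List (ℕ × ℕ)) (n : ℕ) : PowerSeries ℤ :=
  PowerSeries.mk fun d => ∑ u ∈ Finset.Nat.antidiagonalTuple n d,
    open Classical in if HasPattern L (extendZero u) then (0 : ℤ) else 1

theorem avoidSeries_nil (n : ℕ) : avoidSeries [] n = 0 := by
  ext d
  simp [avoidSeries, HasPattern]

theorem avoidSeries_zero (x : ℕ × ℕ) (L : List (ℕ × ℕ)) (hx : 0 < x.2) :
    avoidSeries (x :: L) 0 = 1 := by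
  ext d
  have h (u : Fin 0 → ℕ) : ¬ HasPattern (x :: L) (extendZero u) := by
    rintro ⟨k, -, h2, -⟩
    simp [extendZero] at h2
    omega
  rcases d with _ | d
  · simp [avoidSeries, h]
  · simp [avoidSeries, PowerSeries.coeff_one]

theorem avoidSeries_succ_cons (g b : ℕ) (L : List (ℕ × ℕ)) (n : ℕ) :
    avoidSeries ((g + 1, b) :: L) (n + 1) =
      PowerSeries.mk 1 * avoidSeries ((g, b) :: L) n := by
  classical
  ext d
  simp only [avoidSeries, PowerSeries.coeff_mul, PowerSeries.coeff_mk,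
    sum_antidiagonalTuple_succ, Pi.one_apply, one_mul]
  refine Finset.sum_congr rfl fun p _ => Finset.sum_congr rfl fun u _ => if_congr ?_ rfl rfl
  rw [hasPattern_succ_cons, extendZero_cons_succ]

theorem avoidSeries_zero_cons (b : ℕ) (L : List (ℕ × ℕ)) (n : ℕ) :
    avoidSeries ((0, b) :: L) (n + 1) =
      PowerSeries.mk (fun i => if i < b then 1 else 0) * avoidSeries ((0, b) :: L) n +
        PowerSeries.X ^ b * PowerSeries.mk 1 * avoidSeries L n := by
  classical
  have hX : (PowerSeries.X ^ b * PowerSeries.mk 1 : PowerSeries ℤ) =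
      PowerSeries.mk fun i => if i < b then 0 else 1 := by
    ext d
    simp only [PowerSeries.coeff_X_pow_mul', PowerSeries.coeff_mk, Pi.one_apply]
    grind
  rw [hX]
  ext d
  simp only [avoidSeries, map_add, PowerSeries.coeff_mul, PowerSeries.coeff_mk,
    sum_antidiagonalTuple_succ]
  rw [← Finset.sum_add_distrib]
  refine Finset.sum_congr rfl fun p _ => ?_
  by_cases h : p.1 < b
  · have h' (u : Fin n → ℕ) := hasPattern_zero_cons_of_lt (L := L)
      (v := extendZero (Fin.cons p.1 u : Fin (n + 1) → ℕ)) (by rwa [extendZero_cons_zero])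
    simp only [h, if_true, one_mul, zero_mul, add_zero]
    refine Finset.sum_congr rfl fun u _ => if_congr ?_ rfl rfl
    rw [h', extendZero_cons_succ]
  · have h' (u : Fin n → ℕ) := hasPattern_zero_cons_of_le (L := L) (b := b)
      (v := extendZero (Fin.cons p.1 u : Fin (n + 1) → ℕ))
      (by rw [extendZero_cons_zero]; omega)
    simp only [h, if_false, one_mul, zero_mul, zero_add]
    refine Finset.sum_congr rfl fun u _ => if_congr ?_ rfl rfl
    rw [h', extendZero_cons_succ]

/-- The least length of a word containing the pattern `L`. -/
def patternLength (L : List (ℕ × ℕ)) : ℕ :=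
  (L.map fun x => x.1 + 1).sum

/-- The complete homogeneous symmetric polynomial of degree `k` in the second entries of `L`. -/
def completeSum : List (ℕ × ℕ) → ℕ → ℕ
  | [], k => if k = 0 then 1 else 0
  | x :: L, k => ∑ p ∈ Finset.HasAntidiagonal.antidiagonal k, x.2 ^ p.1 * completeSum L p.2

theorem completeSum_zero (L : List (ℕ × ℕ)) : completeSum L 0 = 1 := by
  induction L with
  | nil => rfl
  | cons x L ih => simp [completeSum, ih]

theorem completeSum_cons_succ (x : ℕ × ℕ) (L : List (ℕ × ℕ)) (k : ℕ) :
    completeSum (x :: L) (k + 1) = x.2 * completeSum (x :: L) k + completeSum L (k + 1) := by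
  simp only [completeSum, Finset.Nat.sum_antidiagonal_succ, pow_zero, one_mul, Finset.mul_sum,
    pow_succ']
  rw [add_comm]
  simp only [mul_assoc]

theorem exists_polynomial_avoidSeries (n : ℕ) (L : List (ℕ × ℕ)) (hL : L ≠ [])
    (hpos : ∀ x ∈ L, 0 < x.2) :
    ∃ p : Polynomial ℤ,
      (p : PowerSeries ℤ) = (1 - PowerSeries.X) ^ (patternLength L - 1) * avoidSeries L n ∧
      p.eval 1 = if patternLength L ≤ n + 1 then
        (completeSum L (n + 1 - patternLength L) : ℤ) else 0 := by
  induction n generalizing L with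
  | zero =>
    obtain ⟨x, L, rfl⟩ := List.exists_cons_of_ne_nil hL
    rw [avoidSeries_zero _ _ (hpos x (by simp))]
    refine ⟨(1 - Polynomial.X) ^ (patternLength (x :: L) - 1), by simp, ?_⟩
    have h1 : 1 ≤ patternLength (x :: L) := by simp [patternLength]; omega
    split_ifs with h
    · have h2 : patternLength (x :: L) = 1 := by omega
      simp [h2, completeSum_zero]
    · simp
      omega
  | succ n ih =>
    obtain ⟨⟨g, b⟩, L, rfl⟩ := List.exists_cons_of_ne_nil hL
    rcases g with _ | g
    · obtain ⟨p, hp, hp1⟩ := ih ((0, b) :: L) (by simp) hpos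
      have hgeom : (PowerSeries.mk fun i => if i < b then (1 : ℤ) else 0) =
          ((∑ i ∈ Finset.range b, Polynomial.X ^ i : Polynomial ℤ) : PowerSeries ℤ) := by
        ext d
        simp [Polynomial.coeff_X_pow]
      rw [avoidSeries_zero_cons, hgeom]
      have hlen : patternLength ((0, b) :: L) = patternLength L + 1 := by
        simp [patternLength, add_comm]
      rcases eq_or_ne L [] with rfl | hne
      · refine ⟨(∑ i ∈ Finset.range b, Polynomial.X ^ i) * p, ?_, ?_⟩
        · rw [Polynomial.coe_mul, hp, avoidSeries_nil]
          ring
        · have : patternLength ([] : List (ℕ × ℕ)) = 0 := rfl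
          simp [hp1, hlen, this, completeSum_cons_succ, Polynomial.eval_finsetSum]
          simp [completeSum]
      · obtain ⟨q, hq, hq1⟩ := ih L hne fun x hx => hpos x (by simp [hx])
        have h1 : 1 ≤ patternLength L := by
          obtain ⟨y, L, rfl⟩ := List.exists_cons_of_ne_nil hne
          simp [patternLength]
          omega
        obtain ⟨m, hm⟩ : ∃ m, patternLength L = m + 1 := ⟨_, (Nat.sub_add_cancel h1).symm⟩
        refine ⟨(∑ i ∈ Finset.range b, Polynomial.X ^ i) * p + Polynomial.X ^ b * q, ?_, ?_⟩
        · rw [Polynomial.coe_add, Polynomial.coe_mul, Polynomial.coe_mul, hp, hq, hlen, hm,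
            Polynomial.coe_pow, Polynomial.coe_X]
          simp only [Nat.add_sub_cancel]
          linear_combination (-(PowerSeries.X ^ b * (1 - PowerSeries.X) ^ m * avoidSeries L n)) *
            PowerSeries.mk_one_mul_one_sub_eq_one ℤ
        · simp only [Polynomial.eval_add, Polynomial.eval_mul, hp1, hq1, hlen, hm,
            Polynomial.eval_finsetSum, Polynomial.eval_pow, Polynomial.eval_X, one_pow, one_mul,
            Finset.sum_const, Finset.card_range, nsmul_eq_mul, mul_one]
          rcases lt_trichotomy n m with h | rfl | h
          · grind
          · simp [completeSum_zero]
          · obtain ⟨k, rfl⟩ := Nat.exists_eq_add_of_lt h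
            rw [if_pos (by omega), if_pos (by omega), if_pos (by omega),
              show m + k + 1 + 1 - (m + 1 + 1) = k by omega,
              show m + k + 1 + 1 - (m + 1) = k + 1 by omega,
              show m + k + 1 + 1 + 1 - (m + 1 + 1) = k + 1 by omega, completeSum_cons_succ]
            push_cast
            ring
    · obtain ⟨p, hp, hp1⟩ := ih ((g, b) :: L) (by simp) (by simpa using hpos)
      have hlen : patternLength ((g + 1, b) :: L) = patternLength ((g, b) :: L) + 1 := by
        simp [patternLength]
        omega
      have h1 : 1 ≤ patternLength ((g, b) :: L) := by simp [patternLength]; omega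
      obtain ⟨m, hm⟩ : ∃ m, patternLength ((g, b) :: L) = m + 1 :=
        ⟨_, (Nat.sub_add_cancel h1).symm⟩
      refine ⟨p, ?_, ?_⟩
      · rw [hp, avoidSeries_succ_cons, hlen, hm]
        simp only [Nat.add_sub_cancel]
        linear_combination (-((1 - PowerSeries.X) ^ m * avoidSeries ((g, b) :: L) n)) *
          PowerSeries.mk_one_mul_one_sub_eq_one ℤ
      · rw [hp1, hlen]
        simp [completeSum]

theorem gapList_pos (r : ℕ) (μ a : ℕ → ℕ) (ha : ∀ j < r, 0 < a j) :
    ∀ x ∈ gapList r μ a, 0 < x.2 := by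
  induction r generalizing μ a with
  | zero => simp [gapList]
  | succ r ih =>
    simp only [gapList, List.mem_cons, forall_eq_or_imp]
    exact ⟨ha 0 (by omega), ih _ _ fun j hj => ha (j + 1) (by omega)⟩

theorem patternLength_gapList (r : ℕ) (μ a : ℕ → ℕ) (hμ : ∀ j, j + 1 < r + 1 → μ j < μ (j + 1)) :
    patternLength (gapList (r + 1) μ a) = μ r + 1 := by
  induction r generalizing μ a with
  | zero => simp [patternLength, gapList]
  | succ r ih =>
    have h0 : ∀ j, j < r + 1 → μ 0 < μ (j + 1) := fun j hj =>
      strictMonoOn_Iio_of_lt_succ hμ (Set.mem_Iio.2 (by omega)) (Set.mem_Iio.2 (by omega)) (by omega)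
    have hμ' : ∀ j, j + 1 < r + 1 → μ (j + 1) - μ 0 - 1 < μ (j + 1 + 1) - μ 0 - 1 := by
      intro j hj
      have := hμ (j + 1) (by omega)
      have := h0 j (by omega)
      omega
    have h := ih _ (fun i => a (i + 1)) hμ'
    have := h0 r (by omega)
    rw [gapList]
    simp only [patternLength, List.map_cons, List.sum_cons] at h ⊢
    omega

theorem completeSum_gapList (r : ℕ) (μ a : ℕ → ℕ) (k : ℕ) :
    completeSum (gapList r μ a) k =
      ∑ u ∈ Finset.Nat.antidiagonalTuple r k, ∏ i : Fin r, a i ^ u i := by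
  induction r generalizing μ a k with
  | zero => rcases k with _ | k <;> simp [gapList, completeSum]
  | succ r ih =>
    simp [gapList, completeSum, sum_antidiagonalTuple_succ, ih, Fin.prod_univ_succ,
      Finset.mul_sum]

theorem orbitIdeal_orbMon (K : Type*) [Field K] (r : ℕ) (μ a : ℕ → ℕ) :
    orbitIdeal K (orbMon K r μ a) =
      Ideal.span ((fun s => monomial s (1 : K)) '' {s | ∃ π : ℕ → ℕ, StrictMono π ∧
        s = ∑ j ∈ Finset.range r, Finsupp.single (π (μ j)) (a j)}) := by
  have h (π : ℕ → ℕ) : rename π (orbMon K r μ a) =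
      monomial (∑ j ∈ Finset.range r, Finsupp.single (π (μ j)) (a j)) 1 := by
    simp only [orbMon, map_prod, monomial_sum_one, X_pow_eq_monomial, rename_monomial,
      Finsupp.mapDomain_single]
  rw [orbitIdeal]
  congr 1
  ext q
  simp only [h, Set.mem_ofPred_eq, Set.mem_image]
  grind

theorem sum_single_le_iff {r : ℕ} {f a : ℕ → ℕ} (hf : Set.InjOn f (Set.Iio r)) (w : ℕ →₀ ℕ) :
    ∑ j ∈ Finset.range r, Finsupp.single (f j) (a j) ≤ w ↔ ∀ j < r, a j ≤ w (f j) := by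
  have h : ∀ j < r, (∑ i ∈ Finset.range r, Finsupp.single (f i) (a i)) (f j) = a j := by
    intro j hj
    rw [Finsupp.finsetSum_apply, Finset.sum_eq_single j]
    · simp
    · intro i hi hij
      rw [Finsupp.single_eq_of_ne]
      intro h
      exact hij (hf (by simpa using hi) (by simpa using hj) h.symm)
    · simp [hj]
  constructor
  · intro hle j hj
    rw [← h j hj]
    exact hle _
  · intro hw i
    by_cases hi : ∃ j < r, f j = i
    · obtain ⟨j, hj, rfl⟩ := hi
      rw [h j hj]
      exact hw j hj
    · rw [Finsupp.finsetSum_apply, Finset.sum_eq_zero]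
      · exact Nat.zero_le _
      · intro j hj
        rw [Finsupp.single_eq_of_ne]
        rintro rfl
        exact hi ⟨j, by simpa using hj, rfl⟩

theorem hilbF_eq_card (K : Type*) [Field K] {σ : Type*} [Fintype σ] {n : ℕ} (e : Fin n ≃ σ)
    (I : Ideal (MvPolynomial σ K)) (P : (σ →₀ ℕ) → Prop) [DecidablePred P]
    (hI : ∀ f, f ∈ I ↔ ∀ m ∈ f.support, P m) (d : ℕ) :
    hilbF K I d = ((Finset.Nat.antidiagonalTuple n d).filter fun u =>
      ¬ P (Finsupp.equivFunOnFinite.symm (u ∘ e.symm))).card := by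
  set T := (Finset.Nat.antidiagonalTuple n d).filter fun u =>
    ¬ P (Finsupp.equivFunOnFinite.symm (u ∘ e.symm)) with hT
  let φ : homogeneousSubmodule σ K d →ₗ[K] (T → K) :=
    LinearMap.pi fun u => (lcoeff K (Finsupp.equivFunOnFinite.symm (u.1 ∘ e.symm))) ∘ₗ
      (homogeneousSubmodule σ K d).subtype
  have hφ : ∀ f u, φ f u = coeff (Finsupp.equivFunOnFinite.symm (u.1 ∘ e.symm)) f.1 :=
    fun _ _ => rfl
  have hker : LinearMap.ker φ = Submodule.comap (homogeneousSubmodule σ K d).subtype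
      (Submodule.restrictScalars K I) := by
    ext f
    simp only [LinearMap.mem_ker, Submodule.mem_comap, Submodule.restrictScalars_mem,
      Submodule.coe_subtype, hI]
    constructor
    · intro h m hm
      by_contra hP
      have hdeg : m.degree = d := by
        have := f.2 (mem_support_iff.1 hm)
        rwa [Finsupp.degree_eq_weight_one]
      have hm' : Finsupp.equivFunOnFinite.symm ((m ∘ e) ∘ e.symm) = m := by
        ext i
        simp
      have hmem : (m ∘ e : Fin n → ℕ) ∈ T := by
        rw [hT, Finset.mem_filter, hm', Finset.Nat.mem_antidiagonalTuple]
        refine ⟨?_, hP⟩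
        rw [← hdeg, Finsupp.degree_eq_sum, ← e.sum_comp]
        rfl
      have := congrFun h ⟨_, hmem⟩
      rw [hφ, hm'] at this
      exact mem_support_iff.1 hm this
    · intro h
      funext u
      rw [hφ]
      by_contra hne
      exact (Finset.mem_filter.1 u.2).2 (h _ (mem_support_iff.2 hne))
  have hsurj : Function.Surjective φ := by
    classical
    intro c
    have hhom : ∑ u : T, monomial (Finsupp.equivFunOnFinite.symm (u.1 ∘ e.symm)) (c u) ∈
        homogeneousSubmodule σ K d := by
      refine Submodule.sum_mem _ fun u _ => isHomogeneous_monomial _ ?_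
      have := Finset.Nat.mem_antidiagonalTuple.1 (Finset.mem_filter.1 u.2).1
      rw [← this, Finsupp.degree_eq_sum, ← e.sum_comp]
      simp
    refine ⟨⟨_, hhom⟩, ?_⟩
    funext u
    rw [hφ]
    have (x : T) : Finsupp.equivFunOnFinite.symm (x.1 ∘ e.symm) =
        Finsupp.equivFunOnFinite.symm (u.1 ∘ e.symm) ↔ x = u := by
      rw [Equiv.apply_eq_iff_eq, e.symm.surjective.injective_comp_right.eq_iff, Subtype.ext_iff]
    simp [coeff_sum, coeff_monomial, this]
  rw [hilbF, ← hker, (φ.quotKerEquivOfSurjective hsurj).finrank_eq,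
    Module.finrank_fintype_fun_eq_card, Fintype.card_coe]

/-- The variable with index `i + 1`, for `i < n`. -/
def varIdxEquiv (n : ℕ) : Fin n ≃ VarIdx n where
  toFun i := ⟨i + 1, by simp⟩
  invFun j := ⟨j.1 - 1, by have := Finset.mem_Icc.1 j.2; omega⟩
  left_inv i := by simp
  right_inv j := by
    have := Finset.mem_Icc.1 j.2
    ext
    simp
    omega

theorem mem_restr_orbitIdeal (K : Type*) [Field K] {r : ℕ} {μ a : ℕ → ℕ}
    (hμ : Set.InjOn μ (Set.Iio r)) (n : ℕ) (f : MvPolynomial (VarIdx n) K) :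
    f ∈ restr K (orbitIdeal K (orbMon K r μ a)) n ↔ ∀ m ∈ f.support,
      ∃ π : ℕ → ℕ, StrictMono π ∧ ∀ j < r, a j ≤ m.mapDomain Subtype.val (π (μ j)) := by
  classical
  rw [restr, Ideal.mem_comap, orbitIdeal_orbMon, mem_ideal_span_monomial_image]
  have h : (toBig K n f).support = f.support.image (Finsupp.mapDomain Subtype.val) :=
    support_rename_of_injective Subtype.val_injective
  simp only [h, Finset.forall_mem_image, Set.mem_ofPred_eq]
  refine forall₂_congr fun m _ => ?_
  constructor
  · rintro ⟨_, ⟨π, hπ, rfl⟩, hle⟩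
    exact ⟨π, hπ, (sum_single_le_iff (hπ.injective.comp_injOn hμ) _).1 hle⟩
  · rintro ⟨π, hπ, hle⟩
    exact ⟨_, ⟨π, hπ, rfl⟩, (sum_single_le_iff (hπ.injective.comp_injOn hμ) _).2 hle⟩

theorem mapDomain_val_succ {n : ℕ} (u : Fin n → ℕ) (i : ℕ) :
    (Finsupp.equivFunOnFinite.symm (u ∘ (varIdxEquiv n).symm)).mapDomain Subtype.val (i + 1) =
      extendZero u i := by
  by_cases h : i < n
  · have := Finsupp.mapDomain_apply (f := (Subtype.val : VarIdx n → ℕ)) Subtype.val_injective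
      (Finsupp.equivFunOnFinite.symm (u ∘ (varIdxEquiv n).symm)) (varIdxEquiv n ⟨i, h⟩)
    simpa [extendZero, h, varIdxEquiv] using this
  · rw [Finsupp.mapDomain_of_notMem_range]
    · simp [extendZero, h]
    · simp
      omega

theorem exists_strictMono_pred_iff {r : ℕ} {μ a w v : ℕ → ℕ} (hμ : ∀ j < r, 1 ≤ μ j)
    (hw : ∀ i, w (i + 1) = v i) :
    (∃ π : ℕ → ℕ, StrictMono π ∧ ∀ j < r, a j ≤ w (π (μ j))) ↔
      ∃ π : ℕ → ℕ, StrictMono π ∧ ∀ j < r, a j ≤ v (π (μ j - 1)) := by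
  constructor
  · rintro ⟨π, hπ, h⟩
    refine ⟨fun x => π (x + 1) - 1, ?_, ?_⟩
    · intro x y hxy
      have h1 : π (x + 1) < π (y + 1) := hπ (by omega)
      have h2 : x + 1 ≤ π (x + 1) := hπ.id_le _
      dsimp only
      omega
    · intro j hj
      have h1 := hμ j hj
      have h2 : μ j ≤ π (μ j) := hπ.id_le _
      have h3 := h j hj
      dsimp only
      rwa [← hw, Nat.sub_add_cancel h1, Nat.sub_add_cancel (h1.trans h2)]
  · rintro ⟨π, hπ, h⟩
    refine ⟨fun x => if x = 0 then 0 else π (x - 1) + 1, ?_, ?_⟩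
    · intro x y hxy
      have h1 : 0 < x → π (x - 1) < π (y - 1) := fun _ => hπ (by omega)
      grind
    · intro j hj
      have h1 := hμ j hj
      simpa [show μ j ≠ 0 by omega, hw] using h j hj

theorem hseries_restr_orbitIdeal (K : Type*) [Field K] {r : ℕ} {μ a : ℕ → ℕ}
    (hμ1 : ∀ j < r, 1 ≤ μ j) (hμ : ∀ j, j + 1 < r → μ j < μ (j + 1)) (n : ℕ) :
    hseries K (restr K (orbitIdeal K (orbMon K r μ a)) n) =
      avoidSeries (gapList r (fun j => μ j - 1) a) n := by
  classical
  ext d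
  rw [hseries, PowerSeries.coeff_mk, avoidSeries, PowerSeries.coeff_mk,
    hilbF_eq_card K (varIdxEquiv n) _ _ (mem_restr_orbitIdeal K
      (strictMonoOn_Iio_of_lt_succ hμ).injOn n), Finset.card_filter]
  push_cast
  refine Finset.sum_congr rfl fun u _ => ?_
  have h : ∀ j, j + 1 < r → μ j - 1 < μ (j + 1) - 1 := by
    intro j hj
    have := hμ j hj
    have := hμ1 j (by omega)
    omega
  rw [hasPattern_gapList r _ _ _ h,
    ← exists_strictMono_pred_iff hμ1 (mapDomain_val_succ u), ite_not]

/-- For `n ≥ μ_r - 1`, `f_n(t) = (1-t)^{μ_r-1}·H_{A_n}(t)` is a polynomial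
in `ℤ[t]` and `f_n(1) = Σ_{k₁+⋯+k_r = n-μ_r+1} a₁^{k₁}⋯a_r^{k_r}`, the coefficient of
`t^{n-μ_r+1}` in `∏ᵢ 1/(1-aᵢt)`. -/
theorem statement8 (K : Type*) [Field K] (r : ℕ) (hr : 1 ≤ r) (μ a : ℕ → ℕ)
    (hμ1 : 1 ≤ μ 0) (hμ : ∀ j, j + 1 < r → μ j < μ (j + 1))
    (ha : ∀ j, j < r → 0 < a j) (n : ℕ) (hn : μ (r - 1) ≤ n + 1) :
    ∃ p : Polynomial ℤ,
      (↑p : PowerSeries ℤ) =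
        (1 - PowerSeries.X : PowerSeries ℤ) ^ (μ (r - 1) - 1) *
          hseries K (restr K (orbitIdeal K (orbMon K r μ a)) n) ∧
      p.eval 1 =
        ((∑ k ∈ Finset.Nat.antidiagonalTuple r (n + 1 - μ (r - 1)),
          ∏ i : Fin r, a i ^ k i : ℕ) : ℤ) := by
  obtain ⟨s, rfl⟩ : ∃ s, r = s + 1 := ⟨r - 1, by omega⟩
  have hmono := strictMonoOn_Iio_of_lt_succ hμ
  have hpos : ∀ j < s + 1, 1 ≤ μ j := by
    intro j hj
    rcases Nat.eq_zero_or_pos j with rfl | h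
    · exact hμ1
    · have := hmono (Set.mem_Iio.2 (Nat.succ_pos s)) hj h
      omega
  have hμ' : ∀ j, j + 1 < s + 1 → μ j - 1 < μ (j + 1) - 1 := by
    intro j hj
    have := hμ j hj
    have := hpos j (by omega)
    omega
  obtain ⟨p, hp, hp1⟩ := exists_polynomial_avoidSeries n
    (gapList (s + 1) (fun j => μ j - 1) a) (by simp [gapList]) (gapList_pos _ _ _ ha)
  have hs := hpos s (by omega)
  simp only [Nat.add_sub_cancel] at hn ⊢
  rw [patternLength_gapList _ _ _ hμ', Nat.sub_add_cancel hs] at hp hp1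
  refine ⟨p, ?_, ?_⟩
  · rw [hp, hseries_restr_orbitIdeal K hpos hμ]
  · rw [hp1, if_pos hn, completeSum_gapList]
end

section
/- Assume r ≥ 2 and set δ_r = μ_r − μ_{r−1}. For every n ≥ μ_r, one has deg I_n = a_r · deg I_{n−1} + deg J_{n−δ_r}. -/
open MvPolynomial

section StandardMonomials

/-- The generating function by degree of a set of exponent vectors. -/
noncomputable def degreeSeries {σ : Type*} (S : Set (σ →₀ ℕ)) : PowerSeries ℤ :=
  PowerSeries.mk fun j => ({d ∈ S | d.degree = j}.ncard : ℤ)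

/-- Exponent vectors of monomials in the variables `x_1, …, x_n`. -/
def expBox (n : ℕ) : Set (ℕ →₀ ℕ) := {d | d.support ⊆ Finset.Icc 1 n}

/-- Exponent vectors whose reduction modulo `x_i` lies in `S`. -/
def cylinder (i : ℕ) (S : Set (ℕ →₀ ℕ)) : Set (ℕ →₀ ℕ) := {d | d.erase i ∈ S}

/-- `x^d` is divisible by `∏_{j<r} x_{π (μ j)}^{a j}` for a strictly increasing `π` with
`π (μ (r-1)) ≤ m`. -/
def OrbitDvd (r : ℕ) (μ a : ℕ → ℕ) (m : ℕ) (d : ℕ →₀ ℕ) : Prop :=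
  ∃ π : ℕ → ℕ, StrictMono π ∧ π (μ (r - 1)) ≤ m ∧ ∀ j < r, a j ≤ d (π (μ j))

/-- Exponent vectors in `x_1, …, x_n` avoiding the part of the orbit supported on indices at
most `m`. -/
def standardExps (r : ℕ) (μ a : ℕ → ℕ) (m n : ℕ) : Set (ℕ →₀ ℕ) :=
  {d ∈ expBox n | ¬ OrbitDvd r μ a m d}

lemma expBox_eq_range (n : ℕ) :
    expBox n = Set.range (Finsupp.mapDomain (Subtype.val : VarIdx n → ℕ) (M := ℕ)) := by
  ext d
  constructor
  · intro hd
    refine ⟨_, Finsupp.mapDomain_comapDomain _ Subtype.val_injective d ?_⟩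
    intro x hx
    exact ⟨⟨x, hd hx⟩, rfl⟩
  · rintro ⟨e, rfl⟩ x hx
    obtain ⟨y, -, rfl⟩ := Finset.mem_image.1 (Finsupp.mapDomain_support hx)
    exact y.2

lemma finite_degree_eq_of_subset_expBox {n : ℕ} {S : Set (ℕ →₀ ℕ)} (hS : S ⊆ expBox n) (j : ℕ) :
    {d ∈ S | d.degree = j}.Finite := by
  refine ((Finsupp.finite_of_degree_eq (σ := VarIdx n) j).image
    (Finsupp.mapDomain Subtype.val)).subset ?_
  rintro d ⟨hd, hj⟩
  have h := hS hd
  rw [expBox_eq_range] at h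
  obtain ⟨e, rfl⟩ := h
  exact ⟨e, by simpa [Finsupp.degree_mapDomain] using hj, rfl⟩

lemma degreeSeries_union {n : ℕ} {S T : Set (ℕ →₀ ℕ)} (hS : S ⊆ expBox n) (hT : T ⊆ expBox n)
    (hST : Disjoint S T) : degreeSeries (S ∪ T) = degreeSeries S + degreeSeries T := by
  ext j
  simp only [degreeSeries, PowerSeries.coeff_mk, map_add]
  rw [← Nat.cast_add, ← Set.ncard_union_eq _ (finite_degree_eq_of_subset_expBox hS j)
    (finite_degree_eq_of_subset_expBox hT j)]
  · congr 2
    ext d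
    simp only [Set.mem_ofPred_eq, Set.mem_union]
    tauto
  · exact hST.mono (Set.sep_subset _ _) (Set.sep_subset _ _)

lemma degreeSeries_image_of_degree {σ τ : Type*} {f : (σ →₀ ℕ) → (τ →₀ ℕ)}
    (hf : Function.Injective f) (k : ℕ) (hk : ∀ d, (f d).degree = d.degree + k)
    (S : Set (σ →₀ ℕ)) : degreeSeries (f '' S) = PowerSeries.X ^ k * degreeSeries S := by
  ext j
  rw [PowerSeries.coeff_X_pow_mul']
  simp only [degreeSeries, PowerSeries.coeff_mk]
  split_ifs with hj
  · rw [← Set.ncard_image_of_injective _ hf]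
    congr 2
    ext d
    constructor
    · rintro ⟨⟨e, he, rfl⟩, h⟩
      exact ⟨e, ⟨he, by rw [hk] at h; omega⟩, rfl⟩
    · rintro ⟨e, ⟨he, h⟩, rfl⟩
      exact ⟨⟨e, he, rfl⟩, by rw [hk]; omega⟩
  · have : {d ∈ f '' S | d.degree = j} = ∅ := by
      ext d
      simp only [Set.mem_ofPred_eq, Set.mem_empty_iff_false, iff_false]
      rintro ⟨⟨e, he, rfl⟩, h⟩
      rw [hk] at h
      omega
    rw [this, Set.ncard_empty, Nat.cast_zero]

lemma degreeSeries_cylinder_le (i k : ℕ) (S : Set (ℕ →₀ ℕ)) :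
    degreeSeries {d ∈ cylinder i S | k ≤ d i} =
      PowerSeries.X ^ k * degreeSeries (cylinder i S) := by
  rw [← degreeSeries_image_of_degree (f := fun d => d + Finsupp.single i k)
    (add_left_injective _) k (by simp)]
  congr 1
  ext d
  constructor
  · rintro ⟨hd, hk⟩
    have hle : Finsupp.single i k ≤ d := by simpa using hk
    refine ⟨d - Finsupp.single i k, ?_, tsub_add_cancel_of_le hle⟩
    have : (d - Finsupp.single i k).erase i = d.erase i := by
      ext x
      by_cases hx : x = i
      · simp [hx]
      · simp [Finsupp.erase_ne hx, Finsupp.single_eq_of_ne hx]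
    simpa [cylinder, this] using hd
  · rintro ⟨e, he, rfl⟩
    refine ⟨?_, by simp⟩
    simpa [cylinder, Finsupp.erase_add] using he

lemma cylinder_subset_expBox {n : ℕ} {S : Set (ℕ →₀ ℕ)} (hS : S ⊆ expBox n) :
    cylinder (n + 1) S ⊆ expBox (n + 1) := by
  intro d hd x hx
  by_cases h : x = n + 1
  · simp [h]
  · have hsub : (d.erase (n + 1)).support ⊆ Finset.Icc 1 n := hS hd
    have := @hsub x (by simpa [Finsupp.support_erase, h] using hx)
    simp only [Finset.mem_Icc] at this ⊢
    omega

lemma apply_eq_zero_of_mem_expBox {n x : ℕ} {d : ℕ →₀ ℕ} (hd : d ∈ expBox n) (hx : n < x) :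
    d x = 0 := by
  by_contra h
  have := hd (Finsupp.mem_support_iff.2 h)
  simp only [Finset.mem_Icc] at this
  omega

lemma degreeSeries_cylinder_lt_add {n : ℕ} {S : Set (ℕ →₀ ℕ)} (hS : S ⊆ expBox n) (k : ℕ) :
    degreeSeries {d ∈ cylinder (n + 1) S | d (n + 1) < k} +
      PowerSeries.X ^ k * degreeSeries (cylinder (n + 1) S) =
        degreeSeries (cylinder (n + 1) S) := by
  have hC := cylinder_subset_expBox hS
  rw [← degreeSeries_cylinder_le, ← degreeSeries_union (n := n + 1)
    ((Set.sep_subset _ _).trans hC) ((Set.sep_subset _ _).trans hC)]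
  · congr 1
    ext d
    simp only [Set.mem_union, Set.mem_ofPred_eq, ← and_or_left, lt_or_ge, and_true]
  · rw [Set.disjoint_left]
    rintro d ⟨-, h⟩ ⟨-, h'⟩
    omega

lemma one_sub_X_mul_degreeSeries_cylinder {n : ℕ} {S : Set (ℕ →₀ ℕ)} (hS : S ⊆ expBox n) :
    (1 - PowerSeries.X) * degreeSeries (cylinder (n + 1) S) = degreeSeries S := by
  have h := degreeSeries_cylinder_lt_add hS 1
  have hset : {d ∈ cylinder (n + 1) S | d (n + 1) < 1} = S := by
    ext d
    simp only [Nat.lt_one_iff, Set.mem_ofPred_eq, cylinder]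
    constructor
    · rintro ⟨hd, h0⟩
      rwa [Finsupp.erase_of_notMem_support (by simpa using h0)] at hd
    · intro hd
      have h0 := apply_eq_zero_of_mem_expBox (hS hd) n.lt_succ_self
      refine ⟨?_, h0⟩
      rwa [Finsupp.erase_of_notMem_support (by simpa using h0)]
  rw [hset] at h
  linear_combination -h

lemma standardExps_subset (r : ℕ) (μ a : ℕ → ℕ) (m n : ℕ) :
    standardExps r μ a m n ⊆ expBox n := Set.sep_subset _ _

lemma orbitDvd_congr {r : ℕ} {μ a : ℕ → ℕ} {m : ℕ} (hμ : MonotoneOn μ (Set.Iio r))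
    {d e : ℕ →₀ ℕ} (hde : ∀ x ≤ m, d x = e x) : OrbitDvd r μ a m d ↔ OrbitDvd r μ a m e := by
  refine exists_congr fun π => and_congr_right fun hπ => and_congr_right fun hm =>
    forall₂_congr fun j hj => ?_
  rw [hde _ ((hπ.monotone (hμ hj (Set.mem_Iio.2 (by omega)) (by omega))).trans hm)]

lemma standardExps_succ {r : ℕ} {μ a : ℕ → ℕ} {m n : ℕ} (hμ : MonotoneOn μ (Set.Iio r))
    (hmn : m ≤ n) :
    standardExps r μ a m (n + 1) = cylinder (n + 1) (standardExps r μ a m n) := by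
  ext d
  have hd : d ∈ expBox (n + 1) ↔ d.erase (n + 1) ∈ expBox n := by
    constructor
    · intro h x hx
      have hx' : x ≠ n + 1 ∧ d x ≠ 0 := by simpa [Finsupp.support_erase] using hx
      have := @h x (by simpa using hx'.2)
      simp only [Finset.mem_Icc] at this ⊢
      omega
    · exact fun h => cylinder_subset_expBox subset_rfl h
  simp only [standardExps, cylinder, Set.mem_ofPred_eq, hd]
  rw [orbitDvd_congr hμ (e := d.erase (n + 1))]
  intro x hx
  rw [Finsupp.erase_ne (by omega)]

lemma one_sub_X_pow_mul_degreeSeries_standardExps {r : ℕ} {μ a : ℕ → ℕ} (m k : ℕ)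
    (hμ : MonotoneOn μ (Set.Iio r)) :
    (1 - PowerSeries.X) ^ k * degreeSeries (standardExps r μ a m (m + k)) =
      degreeSeries (standardExps r μ a m m) := by
  induction k with
  | zero => simp
  | succ k ih =>
    rw [← add_assoc, standardExps_succ hμ (by omega), pow_succ, mul_assoc,
      one_sub_X_mul_degreeSeries_cylinder (standardExps_subset _ _ _ _ _), ih]

/-- Splitting off the last variable of the largest index. -/
lemma orbitDvd_succ_iff {s : ℕ} {μ a : ℕ → ℕ} (hμ : MonotoneOn μ (Set.Iio (s + 2)))
    (hlt : μ s < μ (s + 1)) (n : ℕ) (hn : μ (s + 1) ≤ n + 1) (d : ℕ →₀ ℕ) :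
    OrbitDvd (s + 2) μ a (n + 1) d ↔ OrbitDvd (s + 2) μ a n (d.erase (n + 1)) ∨
      a (s + 1) ≤ d (n + 1) ∧ OrbitDvd (s + 1) μ a (n + 1 - (μ (s + 1) - μ s)) d := by
  have key : ∀ π : ℕ → ℕ, StrictMono π → (μ (s + 1) - μ s) + π (μ s) ≤ π (μ (s + 1)) := by
    intro π hπ
    have := hπ.add_le_nat (μ (s + 1) - μ s) (μ s)
    rwa [Nat.sub_add_cancel hlt.le] at this
  constructor
  · rintro ⟨π, hπ, hm, hdvd⟩
    simp only [Nat.add_succ_sub_one] at hm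
    rcases Nat.lt_or_ge n (π (μ (s + 1))) with h | h
    · right
      have he : π (μ (s + 1)) = n + 1 := by omega
      refine ⟨he ▸ hdvd (s + 1) (by omega), π, hπ, ?_, fun j hj => hdvd j (by omega)⟩
      have := key π hπ
      simp only [Nat.add_sub_cancel]
      omega
    · left
      rw [orbitDvd_congr hμ (e := d)]
      · exact ⟨π, hπ, h, hdvd⟩
      · intro x hx
        rw [Finsupp.erase_ne (by omega)]
  · rintro (h | ⟨ha, π, hπ, hm, hdvd⟩)
    · rw [orbitDvd_congr hμ (e := d)] at h
      · obtain ⟨π, hπ, h, hdvd⟩ := h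
        exact ⟨π, hπ, h.trans n.le_succ, hdvd⟩
      · intro x hx
        rw [Finsupp.erase_ne (by omega)]
    · simp only [Nat.add_sub_cancel] at hm
      refine ⟨fun x => if x ≤ μ s then π x else x + (n + 1 - μ (s + 1)), ?_, ?_, ?_⟩
      · intro x y hxy
        dsimp only
        split_ifs with hx hy
        · exact hπ hxy
        · have := hπ.monotone hx
          omega
        · omega
        · omega
      · have : ¬ μ (s + 1) ≤ μ s := by omega
        simp only [Nat.add_succ_sub_one, this, if_false]
        omega
      · intro j hj
        rcases Nat.lt_or_ge s j with h | h
        · obtain rfl : j = s + 1 := by omega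
          simpa only [hlt.not_ge, if_false, Nat.add_sub_cancel' hn] using ha
        · have : μ j ≤ μ s := hμ hj (Set.mem_Iio.2 (by omega)) h
          simp only [this, if_true]
          exact hdvd j (by omega)

lemma OrbitDvd.dropLast {s : ℕ} {μ a : ℕ → ℕ} (hlt : μ s < μ (s + 1)) {n : ℕ} {d : ℕ →₀ ℕ}
    (h : OrbitDvd (s + 2) μ a n d) : OrbitDvd (s + 1) μ a (n - (μ (s + 1) - μ s)) d := by
  obtain ⟨π, hπ, hm, hdvd⟩ := h
  refine ⟨π, hπ, ?_, fun j hj => hdvd j (by omega)⟩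
  have := hπ.add_le_nat (μ (s + 1) - μ s) (μ s)
  rw [Nat.sub_add_cancel hlt.le] at this
  simp only [Nat.add_succ_sub_one, Nat.add_sub_cancel] at hm ⊢
  omega

lemma OrbitDvd.mono {r : ℕ} {μ a : ℕ → ℕ} {m n : ℕ} (hmn : m ≤ n) {d : ℕ →₀ ℕ}
    (h : OrbitDvd r μ a m d) : OrbitDvd r μ a n d := by
  obtain ⟨π, hπ, hm, hdvd⟩ := h
  exact ⟨π, hπ, hm.trans hmn, hdvd⟩

lemma one_sub_X_mul_degreeSeries_standardExps_succ {s : ℕ} {μ a : ℕ → ℕ}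
    (hμ : MonotoneOn μ (Set.Iio (s + 2))) (hlt : μ s < μ (s + 1)) (n : ℕ)
    (hn : μ (s + 1) ≤ n + 1) :
    (1 - PowerSeries.X) * degreeSeries (standardExps (s + 2) μ a (n + 1) (n + 1)) =
      (1 - PowerSeries.X ^ a (s + 1)) * degreeSeries (standardExps (s + 2) μ a n n) +
        PowerSeries.X ^ a (s + 1) *
          degreeSeries (standardExps (s + 1) μ a (n + 1 - (μ (s + 1) - μ s)) n) := by
  set m := n + 1 - (μ (s + 1) - μ s) with hm
  set k := a (s + 1)
  set A := standardExps (s + 2) μ a n n with hA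
  set B := standardExps (s + 1) μ a m n with hB
  have hμ' : MonotoneOn μ (Set.Iio (s + 1)) := hμ.mono (Set.Iio_subset_Iio (by omega))
  have hAn : A ⊆ expBox n := standardExps_subset _ _ _ _ _
  have hBn : B ⊆ expBox n := standardExps_subset _ _ _ _ _
  have hcA : cylinder (n + 1) A = standardExps (s + 2) μ a n (n + 1) :=
    (standardExps_succ hμ le_rfl).symm
  have hcB : cylinder (n + 1) B = standardExps (s + 1) μ a m (n + 1) :=
    (standardExps_succ hμ' (by omega)).symm
  have hsplit : standardExps (s + 2) μ a (n + 1) (n + 1) =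
      {d ∈ cylinder (n + 1) A | d (n + 1) < k} ∪ {d ∈ cylinder (n + 1) B | k ≤ d (n + 1)} := by
    rw [hcA, hcB]
    ext d
    have he : OrbitDvd (s + 2) μ a n (d.erase (n + 1)) ↔ OrbitDvd (s + 2) μ a n d := by
      refine orbitDvd_congr hμ fun x hx => ?_
      rw [Finsupp.erase_ne (by omega)]
    have hIJ : OrbitDvd (s + 2) μ a n d → OrbitDvd (s + 1) μ a m d :=
      fun h => (h.dropLast hlt).mono (by omega)
    simp only [standardExps, Set.mem_ofPred_eq, Set.mem_union,
      orbitDvd_succ_iff hμ hlt n hn, he, ← hm]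
    have := lt_or_ge (d (n + 1)) k
    have := not_lt (a := d (n + 1)) (b := k)
    tauto
  have hU : degreeSeries (standardExps (s + 2) μ a (n + 1) (n + 1)) =
      degreeSeries {d ∈ cylinder (n + 1) A | d (n + 1) < k} +
        PowerSeries.X ^ k * degreeSeries (cylinder (n + 1) B) := by
    rw [hsplit, degreeSeries_union (n := n + 1)
      ((Set.sep_subset _ _).trans (cylinder_subset_expBox hAn))
      ((Set.sep_subset _ _).trans (cylinder_subset_expBox hBn)), degreeSeries_cylinder_le]
    rw [Set.disjoint_left]
    rintro d ⟨-, h⟩ ⟨-, h'⟩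
    omega
  have h1 := degreeSeries_cylinder_lt_add hAn k
  have h2 := one_sub_X_mul_degreeSeries_cylinder hAn
  have h3 := one_sub_X_mul_degreeSeries_cylinder hBn
  rw [hU]
  linear_combination (1 - PowerSeries.X) * h1 + (1 - PowerSeries.X ^ k) * h2 +
    PowerSeries.X ^ k * h3

end StandardMonomials

section HilbertSeries

variable {K : Type*} [Field K]

/-- For a monomial ideal, the Hilbert function counts standard monomials. -/
lemma hilbF_eq_ncard {σ : Type*} [Finite σ] (I : Ideal (MvPolynomial σ K))
    (P : (σ →₀ ℕ) → Prop) (hI : ∀ f, f ∈ I ↔ ∀ d ∈ f.support, P d) (j : ℕ) :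
    hilbF K I j = {d | ¬ P d ∧ d.degree = j}.ncard := by
  have hfin : {d : σ →₀ ℕ | ¬ P d ∧ d.degree = j}.Finite :=
    (Finsupp.finite_of_degree_eq j).subset fun d hd => hd.2
  have := hfin.fintype
  let φ : homogeneousSubmodule σ K j →ₗ[K] ({d : σ →₀ ℕ | ¬ P d ∧ d.degree = j} → K) :=
    (LinearMap.pi fun d => lcoeff K d.1) ∘ₗ (homogeneousSubmodule σ K j).subtype
  have hφ : Function.Surjective φ := by
    intro c
    refine ⟨⟨∑ d, monomial d.1 (c d), ?_⟩, ?_⟩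
    · exact Submodule.sum_mem _ fun d _ => isHomogeneous_monomial _ d.2.2
    · ext d
      classical
      simp [φ, coeff_monomial, Subtype.val_inj]
  have hker : Submodule.comap (homogeneousSubmodule σ K j).subtype
      (Submodule.restrictScalars K I) = LinearMap.ker φ := by
    ext f
    simp only [Submodule.mem_comap, Submodule.subtype_apply, Submodule.restrictScalars_mem, hI,
      LinearMap.mem_ker]
    constructor
    · intro h
      ext d
      by_contra hd
      exact d.2.1 (h d.1 (mem_support_iff.2 hd))
    · intro h d hd
      by_contra hP
      have hdeg : d.degree = j := by
        have := f.2
        rw [mem_homogeneousSubmodule] at this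
        rw [Finsupp.degree_eq_weight_one]
        exact this (mem_support_iff.1 hd)
      exact mem_support_iff.1 hd (congrFun h ⟨d, hP, hdeg⟩)
  rw [hilbF, hker, (φ.quotKerEquivOfSurjective hφ).finrank_eq, Module.finrank_fintype_fun_eq_card,
    ← Nat.card_eq_fintype_card, Nat.card_coe_set_eq]

lemma mem_orbitIdeal_orbMon_iff {r : ℕ} {μ a : ℕ → ℕ} (hμ : Set.InjOn μ (Set.Iio r))
    (f : MvPolynomial ℕ K) :
    f ∈ orbitIdeal K (orbMon K r μ a) ↔
      ∀ d ∈ f.support, ∃ π : ℕ → ℕ, StrictMono π ∧ ∀ j < r, a j ≤ d (π (μ j)) := by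
  let g : (ℕ → ℕ) → ℕ →₀ ℕ := fun π => ∑ j ∈ Finset.range r, Finsupp.single (π (μ j)) (a j)
  have hset : {q | ∃ π : ℕ → ℕ, StrictMono π ∧ q = rename π (orbMon K r μ a)} =
      (fun s => monomial s (1 : K)) '' (g '' {π | StrictMono π}) := by
    have hg : ∀ π : ℕ → ℕ, monomial (g π) (1 : K) = rename π (orbMon K r μ a) := by
      intro π
      simp [g, orbMon, monomial_sum_one, X_pow_eq_monomial, map_prod, rename_monomial]
    ext q
    simp only [Set.mem_ofPred_eq, Set.image_image, Set.mem_image, hg]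
    exact exists_congr fun π => and_congr_right fun _ => eq_comm
  rw [orbitIdeal, hset, mem_ideal_span_monomial_image]
  refine forall₂_congr fun d _ => ?_
  simp only [Set.mem_image, Set.mem_ofPred_eq, exists_exists_and_eq_and]
  refine exists_congr fun π => and_congr_right fun hπ => ?_
  constructor
  · intro h j hj
    refine le_trans ?_ (h (π (μ j)))
    rw [Finsupp.finsetSum_apply]
    refine le_trans (by simp) (Finset.single_le_sum
      (f := fun i => Finsupp.single (π (μ i)) (a i) (π (μ j)))
      (fun _ _ => Nat.zero_le _) (Finset.mem_range.2 hj))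
  · intro h x
    rw [Finsupp.finsetSum_apply]
    by_cases hx : ∃ j < r, π (μ j) = x
    · obtain ⟨j, hj, rfl⟩ := hx
      rw [Finset.sum_eq_single j]
      · simpa using h j hj
      · intro i hi hij
        rw [Finsupp.single_eq_of_ne]
        intro he
        exact hij (hμ (Finset.mem_range.1 hi) hj (hπ.injective he.symm))
      · exact fun hj' => absurd (Finset.mem_range.2 hj) hj'
    · rw [Finset.sum_eq_zero]
      · exact Nat.zero_le _
      · intro i hi
        rw [Finsupp.single_eq_of_ne]
        exact fun he => hx ⟨i, Finset.mem_range.1 hi, he.symm⟩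

lemma hseries_restr_orbitIdeal_s9 {r : ℕ} {μ a : ℕ → ℕ} (hμ : Set.InjOn μ (Set.Iio r))
    (hr : 0 < r) (ha : 0 < a (r - 1)) (n : ℕ) :
    hseries K (restr K (orbitIdeal K (orbMon K r μ a)) n) =
      degreeSeries (standardExps r μ a n n) := by
  let ι : (VarIdx n →₀ ℕ) → (ℕ →₀ ℕ) := Finsupp.mapDomain Subtype.val
  have hι : Function.Injective ι := Finsupp.mapDomain_injective Subtype.val_injective
  have hbox : ∀ d, ι d ∈ expBox n := fun d => by rw [expBox_eq_range]; exact ⟨d, rfl⟩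
  have hmem : ∀ f, f ∈ restr K (orbitIdeal K (orbMon K r μ a)) n ↔
      ∀ d ∈ f.support, OrbitDvd r μ a n (ι d) := by
    intro f
    classical
    rw [restr, Ideal.mem_comap, mem_orbitIdeal_orbMon_iff hμ, toBig,
      support_rename_of_injective Subtype.val_injective, Finset.forall_mem_image]
    refine forall₂_congr fun d _ => exists_congr fun π => and_congr_right fun _ =>
      ⟨fun h => ⟨?_, h⟩, fun h => h.2⟩
    by_contra hlt
    have := h (r - 1) (by omega)
    have h0 := apply_eq_zero_of_mem_expBox (hbox d) (not_le.1 hlt)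
    change _ ≤ ι d _ at this
    omega
  have himage : standardExps r μ a n n = ι '' {d | ¬ OrbitDvd r μ a n (ι d)} := by
    ext d
    simp only [standardExps, expBox_eq_range]
    constructor
    · rintro ⟨⟨e, rfl⟩, h⟩
      exact ⟨e, h, rfl⟩
    · rintro ⟨e, h, rfl⟩
      exact ⟨⟨e, rfl⟩, h⟩
  rw [himage, degreeSeries_image_of_degree hι 0 (fun d => by
    simp [ι, Finsupp.degree_mapDomain]), pow_zero, one_mul]
  ext j
  simp only [hseries, degreeSeries, PowerSeries.coeff_mk, hilbF_eq_ncard _ _ hmem]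
  rfl

end HilbertSeries

/-- For `r ≥ 2`, `δ_r = μ_r - μ_{r-1}` and `n ≥ μ_r`:
`deg I_n = a_r·deg I_{n-1} + deg J_{n-δ_r}`, where the degrees are the values at `t = 1`
of the polynomials `(1-t)^{μ_r-1}·H_{K[X_n]/I_n}(t)` etc. -/
theorem statement9 (K : Type*) [Field K] (r : ℕ) (hr : 2 ≤ r) (μ a : ℕ → ℕ)
    (hμ1 : 1 ≤ μ 0) (hμ : ∀ j, j + 1 < r → μ j < μ (j + 1))
    (ha : ∀ j, j < r → 0 < a j) (n : ℕ) (hn : μ (r - 1) ≤ n)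
    (p q h : Polynomial ℤ)
    (hp : (↑p : PowerSeries ℤ) =
      (1 - PowerSeries.X : PowerSeries ℤ) ^ (μ (r - 1) - 1) *
        hseries K (restr K (orbitIdeal K (orbMon K r μ a)) n))
    (hq : (↑q : PowerSeries ℤ) =
      (1 - PowerSeries.X : PowerSeries ℤ) ^ (μ (r - 1) - 1) *
        hseries K (restr K (orbitIdeal K (orbMon K r μ a)) (n - 1)))
    (hh : (↑h : PowerSeries ℤ) =
      (1 - PowerSeries.X : PowerSeries ℤ) ^ (μ (r - 2) - 1) *
        hseries K (restr K (orbitIdeal K (orbMon K (r - 1) μ a))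
          (n - (μ (r - 1) - μ (r - 2))))) :
    p.eval 1 = (a (r - 1) : ℤ) * q.eval 1 + h.eval 1 := by
  obtain ⟨s, rfl⟩ : ∃ s, r = s + 2 := ⟨r - 2, by omega⟩
  simp only [show s + 2 - 1 = s + 1 by omega, show s + 2 - 2 = s by omega] at *
  have hμs : StrictMonoOn μ (Set.Iio (s + 2)) :=
    strictMonoOn_of_lt_succ Set.ordConnected_Iio fun j _ _ hj => hμ j hj
  have hlt := hμ s (by omega)
  have hs : 1 ≤ μ s := hμ1.trans (hμs.monotoneOn (Set.mem_Iio.2 (by omega))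
    (Set.mem_Iio.2 (by omega)) (Nat.zero_le s))
  have hμ' : StrictMonoOn μ (Set.Iio (s + 1)) := hμs.mono (Set.Iio_subset_Iio (by omega))
  obtain ⟨N, rfl⟩ : ∃ N, n = N + 1 := ⟨n - 1, by omega⟩
  rw [Nat.add_sub_cancel] at hq
  rw [hseries_restr_orbitIdeal_s9 hμs.injOn (by omega) (ha _ (by omega))] at hp hq
  rw [hseries_restr_orbitIdeal_s9 hμ'.injOn (by omega) (ha _ (by omega))] at hh
  simp only [show s + 2 - 1 = s + 1 by omega, show s + 2 - 2 = s by omega] at hh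
  set m := N + 1 - (μ (s + 1) - μ s) with hm
  have hrec := one_sub_X_mul_degreeSeries_standardExps_succ (a := a) hμs.monotoneOn hlt N hn
  have hJ := one_sub_X_pow_mul_degreeSeries_standardExps (a := a) m (N - m) hμ'.monotoneOn
  rw [← hm] at hrec
  rw [Nat.add_sub_cancel' (by omega : m ≤ N)] at hJ
  have hexp : μ (s + 1) - 1 = (μ s - 1) + 1 + (N - m) := by omega
  have hPS : ((1 - Polynomial.X) * p : Polynomial ℤ) =
      (1 - Polynomial.X) * ((∑ i ∈ Finset.range (a (s + 1)), Polynomial.X ^ i) * q +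
        Polynomial.X ^ a (s + 1) * h) := by
    have hgeom : (1 - Polynomial.X) * (∑ i ∈ Finset.range (a (s + 1)), Polynomial.X ^ i) =
        (1 - Polynomial.X ^ a (s + 1) : Polynomial ℤ) := mul_neg_geom_sum _ _
    rw [mul_add, ← mul_assoc, hgeom]
    apply Polynomial.coe_injective
    push_cast
    rw [hp, hq, hh, ← hJ]
    have hpow : ((1 : PowerSeries ℤ) - PowerSeries.X) ^ (μ (s + 1) - 1) =
        (1 - PowerSeries.X) ^ (μ s - 1) * (1 - PowerSeries.X) * (1 - PowerSeries.X) ^ (N - m) := by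
      rw [hexp, pow_add, pow_succ]
    linear_combination (1 - PowerSeries.X) ^ (μ (s + 1) - 1) * hrec +
      PowerSeries.X ^ a (s + 1) * degreeSeries (standardExps (s + 1) μ a m N) * hpow
  have hne : (1 - Polynomial.X : Polynomial ℤ) ≠ 0 := by
    intro h0
    simpa using congrArg (Polynomial.eval 0) h0
  rw [mul_left_cancel₀ hne hPS]
  simp [Polynomial.eval_finsetSum]
end
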